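/- Let n ≥ 1, K > 0, ν > 0, and let f : ℝ → ℝⁿ be differentiable and Lipschitz continuous on [-1,1] with Lipschitz constant at most K. Suppose u : [0,∞) × ℝⁿ → ℝ is a smooth solution of ∂ₜu + div(f(u)) = ν Δu on (0,∞) × ℝⁿ that satisfies, for all t ≥ 0, ‖u(t,·)‖_{L^∞} ≤ 1 and ‖∇u(t,·)‖_{L¹} ≤ 1, and for which the Duhamel representation u(t₀+τ,·) = Φ_{ντ} ∗ u(t₀,·) − ∫_{t₀}^{t₀+τ} Φ_{ν(t₀+τ−s)} ∗ div(f(u))(s,·) ds holds for all t₀, τ ≥ 0. Then there exists a constant C > 0 depending only on n and on max(K, sup_{|v|≤1}|f(v)|) such that for every t ≥ ν, ∫_{ℝⁿ} |∇u(t,x)|² dx ≤ C ν⁻¹. -/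

import Mathlib

open MeasureTheory

/-- The partial derivative in the `i`-th coordinate direction. -/
noncomputable def spaceDeriv {n : ℕ} (v : EuclideanSpace ℝ (Fin n) → ℝ) (i : Fin n)
    (x : EuclideanSpace ℝ (Fin n)) : ℝ :=
  fderiv ℝ v x (EuclideanSpace.single i 1)

/-- The Laplacian `Δv = Σᵢ ∂²v/∂xᵢ²`. -/
noncomputable def laplacian {n : ℕ} (v : EuclideanSpace ℝ (Fin n) → ℝ)
    (x : EuclideanSpace ℝ (Fin n)) : ℝ :=
  ∑ i, spaceDeriv (spaceDeriv v i) i x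

/-- The divergence `div (f ∘ v) = Σᵢ ∂ᵢ(fᵢ(v))` of the flux `f` applied to `v`. -/
noncomputable def divFlux {n : ℕ} (f : ℝ → EuclideanSpace ℝ (Fin n))
    (v : EuclideanSpace ℝ (Fin n) → ℝ) (x : EuclideanSpace ℝ (Fin n)) : ℝ :=
  ∑ i, spaceDeriv (fun y => f (v y) i) i x

/-- The heat kernel `Φ_s(x) = (4πs)^{-n/2} exp(-|x|²/(4s))` on `ℝⁿ`. -/
noncomputable def heatKernel (n : ℕ) (s : ℝ) (x : EuclideanSpace ℝ (Fin n)) : ℝ :=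
  (4 * Real.pi * s) ^ (-(n : ℝ) / 2) * Real.exp (-‖x‖ ^ 2 / (4 * s))

open Set Filter Topology
open scoped ContDiff ENNReal

lemma exists_cutoff (n : ℕ) (R ε : ℝ) (hR : 0 < R) (hε : 0 < ε) :
    ∃ φ : EuclideanSpace ℝ (Fin n) → ℝ, ContDiff ℝ ∞ φ ∧ HasCompactSupport φ ∧
      (∀ x, 0 ≤ φ x) ∧ (∀ x, φ x ≤ 1) ∧ (∀ x, ‖x‖ ≤ R → φ x = 1) ∧ (∀ x, ‖fderiv ℝ φ x‖ ≤ ε) := by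
  let χ : ContDiffBump (0 : EuclideanSpace ℝ (Fin n)) := ⟨1, 2, one_pos, one_lt_two⟩
  have hχ : ContDiff ℝ ∞ χ := χ.contDiff
  have hcs : HasCompactSupport χ := χ.hasCompactSupport
  obtain ⟨M, hM⟩ := (hcs.fderiv (𝕜 := ℝ)).exists_bound_of_continuous
    (hχ.continuous_fderiv (by simp))
  have hM0 : 0 ≤ M := (norm_nonneg _).trans (hM 0)
  let ρ := R + M / ε
  have hρ : 0 < ρ := by positivity
  refine ⟨fun x => χ (ρ⁻¹ • x), hχ.comp (contDiff_const_smul _), ?_, fun x => χ.nonneg,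
    fun x => χ.le_one, ?_, ?_⟩
  · exact hcs.comp_smul (inv_ne_zero hρ.ne')
  · intro x hx
    apply χ.one_of_mem_closedBall
    simp only [mem_closedBall_zero_iff, norm_smul, norm_inv, Real.norm_eq_abs, abs_of_pos hρ]
    change ρ⁻¹ * ‖x‖ ≤ 1
    rw [inv_mul_le_iff₀ hρ]
    have : 0 ≤ M / ε := by positivity
    simp only [ρ]; linarith
  · intro x
    have h1 : HasFDerivAt (fun x => χ (ρ⁻¹ • x)) ((fderiv ℝ χ (ρ⁻¹ • x)).comp
        (ρ⁻¹ • ContinuousLinearMap.id ℝ _)) x := by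
      have := ((hχ.differentiable (by simp)) (ρ⁻¹ • x)).hasFDerivAt
      exact this.comp x ((hasFDerivAt_id x).const_smul ρ⁻¹)
    rw [h1.fderiv]
    have h2 := hM (ρ⁻¹ • x)
    simp only [ContinuousLinearMap.comp_smul, ContinuousLinearMap.comp_id, norm_smul, norm_inv,
      Real.norm_eq_abs, abs_of_pos hρ]
    rw [inv_mul_le_iff₀ hρ]
    have h3 : ρ * ε = R * ε + M := by simp only [ρ]; field_simp
    rw [h3]
    have : 0 ≤ R * ε := by positivity
    linarith

lemma integrable_gauss (n : ℕ) {b : ℝ} (hb : 0 < b) :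
    Integrable (fun v : EuclideanSpace ℝ (Fin n) => Real.exp (-b * ‖v‖ ^ 2)) := by
  have h := (GaussianFourier.integrable_cexp_neg_mul_sq_norm_add (b := (b : ℂ)) (by simpa) 0
    (0 : EuclideanSpace ℝ (Fin n))).re
  refine h.congr (Eventually.of_forall fun v => ?_)
  simp only [zero_mul, add_zero]
  rw [show (-(b : ℂ) * (‖v‖ : ℂ) ^ 2) = ((-b * ‖v‖ ^ 2 : ℝ) : ℂ) by push_cast; rfl,
    ← Complex.ofReal_exp]
  rfl

lemma lintegral_gauss (n : ℕ) {b : ℝ} (hb : 0 < b) :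
    ∫⁻ v : EuclideanSpace ℝ (Fin n), ENNReal.ofReal (Real.exp (-b * ‖v‖ ^ 2))
      = ENNReal.ofReal ((Real.pi / b) ^ ((n : ℝ) / 2)) := by
  rw [← ofReal_integral_eq_lintegral_ofReal (integrable_gauss n hb)
    (Eventually.of_forall fun v => (Real.exp_pos _).le),
    GaussianFourier.integral_rexp_neg_mul_sq_norm hb]
  simp

lemma heatKernel_nonneg (n : ℕ) {s : ℝ} (hs : 0 ≤ s) (x) : 0 ≤ heatKernel n s x := by
  unfold heatKernel; positivity

lemma heatKernel_measurable (n : ℕ) :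
    Measurable (fun p : ℝ × EuclideanSpace ℝ (Fin n) => heatKernel n p.1 p.2) := by
  unfold heatKernel; fun_prop

lemma lintegral_heatKernel (n : ℕ) {s : ℝ} (hs : 0 < s) :
    ∫⁻ x, ENNReal.ofReal (heatKernel n s x) = 1 := by
  have h1 : ∀ x, ENNReal.ofReal (heatKernel n s x) =
      ENNReal.ofReal ((4 * Real.pi * s) ^ (-(n : ℝ) / 2)) *
        ENNReal.ofReal (Real.exp (-(1/(4*s)) * ‖x‖ ^ 2)) := by
    intro x
    unfold heatKernel
    rw [ENNReal.ofReal_mul (by positivity)]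
    congr 3; ring
  simp_rw [h1]
  rw [lintegral_const_mul' _ _ ENNReal.ofReal_ne_top, lintegral_gauss n (by positivity),
    ← ENNReal.ofReal_mul (by positivity)]
  rw [show Real.pi / (1 / (4 * s)) = 4 * Real.pi * s by field_simp,
    ← Real.rpow_add (by positivity)]
  rw [show -(n : ℝ) / 2 + n / 2 = 0 by ring]; simp

lemma lintegral_heatKernel_norm (n : ℕ) {s : ℝ} (hs : 0 < s) :
    ∫⁻ x, ENNReal.ofReal (heatKernel n s x) * ‖x‖ₑ ≤
      ENNReal.ofReal (2 ^ ((n : ℝ) / 2) * √(8 * s)) := by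
  have h1 : ∀ x, ENNReal.ofReal (heatKernel n s x) * ‖x‖ₑ ≤
      ENNReal.ofReal ((4 * Real.pi * s) ^ (-(n : ℝ) / 2) * √(8 * s)) *
        ENNReal.ofReal (Real.exp (-(1/(8*s)) * ‖x‖ ^ 2)) := by
    intro x
    unfold heatKernel
    rw [← ofReal_norm, ← ENNReal.ofReal_mul (by positivity),
      ← ENNReal.ofReal_mul (by positivity)]
    apply ENNReal.ofReal_le_ofReal
    have hp : 0 ≤ (4 * Real.pi * s) ^ (-(n : ℝ) / 2) := by positivity
    generalize (4 * Real.pi * s) ^ (-(n : ℝ) / 2) = c at hp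
    rw [mul_assoc, mul_assoc]
    apply mul_le_mul_of_nonneg_left _ hp
    have h2 : Real.exp (-‖x‖ ^ 2 / (4 * s)) =
      Real.exp (-(1/(8*s)) * ‖x‖ ^ 2) * Real.exp (-(1/(8*s)) * ‖x‖ ^ 2) := by
      rw [← Real.exp_add]; congr 1; field_simp; ring
    rw [h2, mul_comm (√(8*s)), mul_assoc]
    apply mul_le_mul_of_nonneg_left _ (by positivity)
    rw [neg_mul, Real.exp_neg, inv_mul_le_iff₀ (by positivity)]
    have h3 := Real.add_one_le_exp (1 / (8 * s) * ‖x‖ ^ 2)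
    have h4 : 0 < √(8 * s) := by positivity
    have h5 : √(8 * s) ^ 2 = 8 * s := Real.sq_sqrt (by positivity)
    have h6 : ‖x‖ ≤ (1 / (8 * s) * ‖x‖ ^ 2 + 1) * √(8 * s) := by
      generalize √(8 * s) = r at h4 h5
      rw [← h5]
      have : (1 / r ^ 2 * ‖x‖ ^ 2 + 1) * r - ‖x‖ =
        ((‖x‖ - r)^2 + ‖x‖ * r) / r := by field_simp; ring
      have h7 : 0 ≤ ((‖x‖ - r)^2 + ‖x‖ * r) / r := by positivity
      linarith
    exact h6.trans (mul_le_mul_of_nonneg_right h3 h4.le)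
  refine (lintegral_mono h1).trans ?_
  rw [lintegral_const_mul' _ _ ENNReal.ofReal_ne_top, lintegral_gauss n (by positivity),
    ← ENNReal.ofReal_mul (by positivity)]
  apply ENNReal.ofReal_le_ofReal
  apply le_of_eq
  rw [show Real.pi / (1 / (8 * s)) = 2 * (4 * Real.pi * s) by field_simp; norm_num,
    Real.mul_rpow (x := 2) (y := 4 * Real.pi * s) (by norm_num) (by positivity)]
  have : (4 * Real.pi * s) ^ (-(n : ℝ) / 2) * (4 * Real.pi * s) ^ ((n : ℝ) / 2) = 1 := by
    rw [← Real.rpow_add (by positivity), show -(n : ℝ) / 2 + n / 2 = 0 by ring]; simp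
  generalize (4 * Real.pi * s) ^ (-(n : ℝ) / 2) = c at *
  generalize (4 * Real.pi * s) ^ ((n : ℝ) / 2) = d at *
  linear_combination (2 ^ ((n : ℝ) / 2) * √(8 * s)) * this

lemma lintegral_translate {n : ℕ} (v : EuclideanSpace ℝ (Fin n) → ℝ) (hv : ContDiff ℝ 1 v)
    (y : EuclideanSpace ℝ (Fin n)) :
    ∫⁻ x, ‖v (x - y) - v x‖ₑ ≤ ‖y‖ₑ * ∫⁻ x, ‖fderiv ℝ v x‖ₑ := by
  have hc : Continuous (fderiv ℝ v) := hv.continuous_fderiv (by simp)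
  have h1 : ∀ x, ‖v (x - y) - v x‖ₑ ≤
      ∫⁻ θ in Ioc (0:ℝ) 1, ‖fderiv ℝ v (x - θ • y)‖ₑ * ‖y‖ₑ := by
    intro x
    have hd : ∀ θ ∈ uIcc (0:ℝ) 1, HasDerivAt (fun θ : ℝ => v (x - θ • y))
        (fderiv ℝ v (x - θ • y) (-y)) θ := by
      intro θ _
      have h := ((hv.differentiable (by simp)) (x - θ • y)).hasFDerivAt
      have h' : HasDerivAt (fun θ : ℝ => x - θ • y) (-y) θ := by
        simpa using ((hasDerivAt_id θ).smul_const y).const_sub x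
      exact h.comp_hasDerivAt θ h'
    have hcont : Continuous fun θ : ℝ => fderiv ℝ v (x - θ • y) (-y) :=
      (hc.comp (by fun_prop)).clm_apply continuous_const
    have h := intervalIntegral.integral_eq_sub_of_hasDerivAt hd (hcont.intervalIntegrable _ _)
    simp only [one_smul, zero_smul, sub_zero] at h
    rw [← h, intervalIntegral.integral_of_le zero_le_one]
    refine (enorm_integral_le_lintegral_enorm _).trans (lintegral_mono fun θ => ?_)
    refine (ContinuousLinearMap.le_opENorm _ _).trans ?_
    simp
  refine (lintegral_mono h1).trans ?_
  rw [lintegral_lintegral_swap]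
  · have : ∀ θ : ℝ, ∫⁻ x, ‖fderiv ℝ v (x - θ • y)‖ₑ * ‖y‖ₑ = ‖y‖ₑ * ∫⁻ x, ‖fderiv ℝ v x‖ₑ := by
      intro θ
      rw [lintegral_mul_const' _ _ (by simp), mul_comm]
      congr 1
      exact lintegral_sub_right_eq_self (fun x => ‖fderiv ℝ v x‖ₑ) (θ • y)
    simp_rw [this]
    simp
  · apply Measurable.aemeasurable
    apply Continuous.measurable
    apply ENNReal.continuous_mul_const (by simp) |>.comp
    exact (hc.comp (by fun_prop)).enorm

lemma integral_heatKernel (n : ℕ) {s : ℝ} (hs : 0 < s) : ∫ x, heatKernel n s x = 1 := by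
  rw [integral_eq_lintegral_of_nonneg_ae (Eventually.of_forall fun x => heatKernel_nonneg n hs.le x)
    ((heatKernel_measurable n).comp measurable_prodMk_left).aestronglyMeasurable,
    lintegral_heatKernel n hs]
  simp

lemma integrable_heatKernel (n : ℕ) {s : ℝ} (hs : 0 < s) :
    Integrable (fun x => heatKernel n s x) := by
  by_contra h
  have := integral_heatKernel n hs
  rw [integral_undef h] at this
  exact zero_ne_one this

lemma L1_diff {n : ℕ} (ν K : ℝ) (hν : 0 < ν) (hK : 0 ≤ K)
    (f : ℝ → EuclideanSpace ℝ (Fin n)) (u : ℝ → EuclideanSpace ℝ (Fin n) → ℝ)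
    (t₀ τ : ℝ) (hτ : 0 < τ) (hu : ContDiff ℝ 1 (u t₀)) (hu1 : ∀ x, |u t₀ x| ≤ 1)
    (g : ℝ → EuclideanSpace ℝ (Fin n) → ℝ) (hgc : Continuous (Function.uncurry g))
    (hg : ∀ s ∈ Ioc t₀ (t₀ + τ), ∀ y, |divFlux f (u s) y| ≤ K * g s y)
    (hg1 : ∀ s ∈ Ioc t₀ (t₀ + τ), ∫⁻ y, ENNReal.ofReal (g s y) ≤ 1)
    (hgrad : ∫⁻ y, ‖fderiv ℝ (u t₀) y‖ₑ ≤ 1)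
    (hD : ∀ x, u (t₀ + τ) x
              = (∫ y, heatKernel n (ν * τ) (x - y) * u t₀ y)
                - ∫ s in t₀..(t₀ + τ), ∫ y,
                    heatKernel n (ν * (t₀ + τ - s)) (x - y) * divFlux f (u s) y) :
    ∫⁻ x, ‖u (t₀ + τ) x - u t₀ x‖ₑ ≤
      ENNReal.ofReal (2 ^ ((n : ℝ) / 2) * √(8 * (ν * τ)) + K * τ) := by
  have hντ : 0 < ν * τ := by positivity
  have hpt : ∀ x, ‖u (t₀ + τ) x - u t₀ x‖ₑ ≤
      (∫⁻ y, ENNReal.ofReal (heatKernel n (ν * τ) y) * ‖u t₀ (x - y) - u t₀ x‖ₑ) +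
      ∫⁻ s in Ioc t₀ (t₀ + τ), ∫⁻ y, ENNReal.ofReal (heatKernel n (ν * (t₀ + τ - s)) (x - y)) *
        (ENNReal.ofReal K * ENNReal.ofReal (g s y)) := by
    intro x
    have hi : Integrable (fun y => heatKernel n (ν * τ) (x - y)) :=
      (integrable_heatKernel n hντ).comp_sub_left x
    have h1 : ∫ y, heatKernel n (ν * τ) (x - y) = 1 := by
      rw [integral_sub_left_eq_self (fun y => heatKernel n (ν * τ) y), integral_heatKernel n hντ]
    have hi2 : Integrable (fun y => heatKernel n (ν * τ) (x - y) * u t₀ y) :=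
      hi.mul_bdd (c := 1) hu.continuous.aestronglyMeasurable (Eventually.of_forall hu1)
    have e : u (t₀ + τ) x - u t₀ x = (∫ y, heatKernel n (ν * τ) (x - y) * (u t₀ y - u t₀ x))
        - ∫ s in t₀..(t₀ + τ), ∫ y,
                    heatKernel n (ν * (t₀ + τ - s)) (x - y) * divFlux f (u s) y := by
      simp_rw [mul_sub]
      rw [integral_sub hi2 (hi.mul_const _), integral_mul_const, h1, hD x]; ring_nf
    rw [e]
    refine enorm_sub_le.trans (add_le_add ?_ ?_)
    · refine (enorm_integral_le_lintegral_enorm _).trans ?_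
      rw [← lintegral_sub_left_eq_self _ x]
      refine lintegral_mono fun y => ?_
      rw [enorm_mul, Real.enorm_of_nonneg (heatKernel_nonneg n hντ.le _)]
      simp
    · rw [intervalIntegral.integral_of_le (by linarith)]
      refine (enorm_integral_le_lintegral_enorm _).trans ?_
      refine setLIntegral_mono' measurableSet_Ioc fun s hs => ?_
      refine (enorm_integral_le_lintegral_enorm _).trans ?_
      refine lintegral_mono fun y => ?_
      have : 0 ≤ ν * (t₀ + τ - s) := mul_nonneg hν.le (by linarith [hs.2])
      simp only
      rw [enorm_mul, Real.enorm_of_nonneg (heatKernel_nonneg n this _),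
        ← ENNReal.ofReal_mul hK, Real.enorm_eq_ofReal_abs]
      gcongr
      exact hg s hs y
  refine (lintegral_mono hpt).trans ?_
  have hm1 : Measurable fun p : EuclideanSpace ℝ (Fin n) × EuclideanSpace ℝ (Fin n) =>
      ENNReal.ofReal (heatKernel n (ν * τ) p.2) * ‖u t₀ (p.1 - p.2) - u t₀ p.1‖ₑ := by
    have h1 : Measurable fun p : EuclideanSpace ℝ (Fin n) × EuclideanSpace ℝ (Fin n) =>
      heatKernel n (ν * τ) p.2 :=
      (heatKernel_measurable n).comp (measurable_const.prodMk measurable_snd)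
    have h2 := hu.continuous
    have h3 : Continuous fun p : EuclideanSpace ℝ (Fin n) × EuclideanSpace ℝ (Fin n) =>
      u t₀ (p.1 - p.2) - u t₀ p.1 := by fun_prop
    exact h1.ennreal_ofReal.mul h3.enorm.measurable
  rw [lintegral_add_left hm1.lintegral_prod_right', ENNReal.ofReal_add (by positivity) (by positivity)]
  refine add_le_add ?_ ?_
  · rw [lintegral_lintegral_swap hm1.aemeasurable]
    refine le_trans (lintegral_mono fun y => ?_) (lintegral_heatKernel_norm n hντ)
    simp only
    rw [lintegral_const_mul' _ _ ENNReal.ofReal_ne_top]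
    gcongr
    refine (lintegral_translate _ hu y).trans ?_
    calc _ ≤ ‖y‖ₑ * 1 := by gcongr
      _ = _ := mul_one _
  · have hm2 : Measurable fun p : (EuclideanSpace ℝ (Fin n) × ℝ) × EuclideanSpace ℝ (Fin n) =>
        ENNReal.ofReal (heatKernel n (ν * (t₀ + τ - p.1.2)) (p.1.1 - p.2)) *
        (ENNReal.ofReal K * ENNReal.ofReal (g p.1.2 p.2)) := by
      have h1 : Measurable fun p : (EuclideanSpace ℝ (Fin n) × ℝ) × EuclideanSpace ℝ (Fin n) =>
        heatKernel n (ν * (t₀ + τ - p.1.2)) (p.1.1 - p.2) := by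
        refine (heatKernel_measurable n).comp (Measurable.prodMk ?_ ?_) <;> fun_prop
      have h2 : Measurable fun p : (EuclideanSpace ℝ (Fin n) × ℝ) × EuclideanSpace ℝ (Fin n) =>
        g p.1.2 p.2 := hgc.measurable.comp (Measurable.prodMk (by fun_prop) (by fun_prop))
      exact h1.ennreal_ofReal.mul (h2.ennreal_ofReal.const_mul _)
    rw [lintegral_lintegral_swap hm2.lintegral_prod_right'.aemeasurable]
    have hs1 : ∀ s ∈ Ioc t₀ (t₀ + τ), ∫⁻ x, ∫⁻ y,
        ENNReal.ofReal (heatKernel n (ν * (t₀ + τ - s)) (x - y)) *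
        (ENNReal.ofReal K * ENNReal.ofReal (g s y)) ≤ ENNReal.ofReal K := by
      intro s hs
      have hm3 : Measurable (Function.uncurry fun x y : EuclideanSpace ℝ (Fin n) =>
        ENNReal.ofReal (heatKernel n (ν * (t₀ + τ - s)) (x - y)) *
        (ENNReal.ofReal K * ENNReal.ofReal (g s y))) := hm2.comp (f := fun p : EuclideanSpace ℝ (Fin n) × EuclideanSpace ℝ (Fin n) =>
        ((p.1, s), p.2)) (by fun_prop)
      rw [lintegral_lintegral_swap hm3.aemeasurable]
      have : ∀ y, ∫⁻ x, ENNReal.ofReal (heatKernel n (ν * (t₀ + τ - s)) (x - y)) *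
        (ENNReal.ofReal K * ENNReal.ofReal (g s y)) ≤
          ENNReal.ofReal K * ENNReal.ofReal (g s y) := by
        intro y
        rw [lintegral_mul_const' _ _ (by finiteness),
          lintegral_sub_right_eq_self
            (fun x => ENNReal.ofReal (heatKernel n (ν * (t₀ + τ - s)) x)) y]
        have hle : ∫⁻ x, ENNReal.ofReal (heatKernel n (ν * (t₀ + τ - s)) x) ≤ 1 := by
          rcases hs.2.lt_or_eq with h | h
          · exact (lintegral_heatKernel n (mul_pos hν (by linarith))).le
          · rcases Nat.eq_zero_or_pos n with rfl | hn
            · have : ∀ x, heatKernel 0 (ν * (t₀ + τ - s)) x = 1 := by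
                intro x; simp [heatKernel, h]
              have h2 := lintegral_heatKernel 0 one_pos
              have h3 : ∀ x, heatKernel 0 1 x = 1 := by
                intro x; simp [heatKernel, Subsingleton.elim x 0]
              simp_rw [this]; simp_rw [h3] at h2; exact h2.le
            · have : ∀ x, heatKernel n (ν * (t₀ + τ - s)) x = 0 := by
                intro x
                simp only [heatKernel, h, sub_self, mul_zero]
                rw [Real.zero_rpow, zero_mul]
                have : (0:ℝ) < n := by exact_mod_cast hn
                have := this.ne'
                simp [this]
              simp [this]
        calc _ ≤ 1 * (ENNReal.ofReal K * ENNReal.ofReal (g s y)) := by gcongr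
          _ = _ := one_mul _
      refine (lintegral_mono this).trans ?_
      rw [lintegral_const_mul' _ _ ENNReal.ofReal_ne_top]
      calc _ ≤ ENNReal.ofReal K * 1 := by gcongr; exact hg1 s hs
        _ = _ := mul_one _
    refine (setLIntegral_mono' measurableSet_Ioc hs1).trans ?_
    simp [ENNReal.ofReal_mul hK]

lemma norm_sq_fderiv {n : ℕ} (v : EuclideanSpace ℝ (Fin n) → ℝ) (x) :
    ‖fderiv ℝ v x‖ ^ 2 = ∑ i, spaceDeriv v i x ^ 2 := by
  rw [(EuclideanSpace.basisFun (Fin n) ℝ).norm_dual]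
  simp [spaceDeriv]

lemma sum_mul_le {n : ℕ} (v w : EuclideanSpace ℝ (Fin n) → ℝ) (x) :
    |∑ i, spaceDeriv v i x * spaceDeriv w i x| ≤ ‖fderiv ℝ v x‖ * ‖fderiv ℝ w x‖ := by
  apply abs_le_of_sq_le_sq _ (by positivity)
  rw [mul_pow, norm_sq_fderiv, norm_sq_fderiv]
  exact Finset.sum_mul_sq_le_sq_mul_sq _ _ _

lemma norm_deriv_le_of_lipschitzOn_Icc {F : Type*} [NormedAddCommGroup F] [NormedSpace ℝ F]
    {f : ℝ → F} (hf : Differentiable ℝ f) {K : ℝ}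
    (hK : 0 < K) (hL : LipschitzOnWith K.toNNReal f (Icc (-1) 1)) {v : ℝ} (hv : |v| ≤ 1) :
    ‖deriv f v‖ ≤ K := by
  have hv' : v ∈ Icc (-1:ℝ) 1 := abs_le.1 hv
  have h1 : HasDerivWithinAt f (deriv f v) (Icc (-1) 1) v := (hf v).hasDerivAt.hasDerivWithinAt
  rw [hasDerivWithinAt_iff_tendsto_slope] at h1
  have hne : (𝓝[Icc (-1:ℝ) 1 \ {v}] v).NeBot := by
    have h2 := (uniqueDiffOn_Icc (show (-1:ℝ) < 1 by norm_num)) v hv'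
    exact accPt_principal_iff_nhdsWithin.1 h2.accPt
  refine le_of_tendsto h1.norm ?_
  filter_upwards [self_mem_nhdsWithin] with y hy
  have h3 := hL.dist_le_mul y hy.1 v hv'
  rw [Real.coe_toNNReal _ hK.le, dist_eq_norm, Real.dist_eq] at h3
  have h4 : 0 < |y - v| := abs_pos.2 (sub_ne_zero.2 hy.2)
  rw [slope_def_module, norm_smul, norm_inv, Real.norm_eq_abs, inv_mul_le_iff₀ h4]
  linarith

lemma divFlux_eq {n : ℕ} {f : ℝ → EuclideanSpace ℝ (Fin n)} (hf : Differentiable ℝ f)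
    {v : EuclideanSpace ℝ (Fin n) → ℝ} (hv : Differentiable ℝ v) (x) :
    divFlux f v x = ∑ i, deriv f (v x) i * spaceDeriv v i x := by
  unfold divFlux
  refine Finset.sum_congr rfl fun i _ => ?_
  have h1 : HasDerivAt (fun s => f s i) (deriv f (v x) i) (v x) := by
    have := (hf (v x)).hasDerivAt
    exact (EuclideanSpace.proj (𝕜 := ℝ) i).hasFDerivAt.comp_hasDerivAt (v x) this
  have h2 := h1.comp_hasFDerivAt x (hv x).hasFDerivAt
  unfold spaceDeriv
  have h3 : fderiv ℝ (fun y => f (v y) i) x = deriv f (v x) i • fderiv ℝ v x := h2.fderiv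
  rw [h3]; simp

lemma divFlux_le {n : ℕ} {f : ℝ → EuclideanSpace ℝ (Fin n)} (hf : Differentiable ℝ f)
    {v : EuclideanSpace ℝ (Fin n) → ℝ} (hv : Differentiable ℝ v) {K : ℝ}
    (hK : 0 < K) (hL : LipschitzOnWith K.toNNReal f (Icc (-1) 1)) (h1 : ∀ x, |v x| ≤ 1) (x) :
    |divFlux f v x| ≤ K * ‖fderiv ℝ v x‖ := by
  rw [divFlux_eq hf hv]
  apply abs_le_of_sq_le_sq _ (by positivity)
  refine (Finset.sum_mul_sq_le_sq_mul_sq _ _ _).trans ?_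
  rw [← norm_sq_fderiv, mul_pow]
  gcongr
  have := norm_deriv_le_of_lipschitzOn_Icc hf hK hL (h1 x)
  have h2 := EuclideanSpace.norm_sq_eq (deriv f (v x))
  simp only [Real.norm_eq_abs, sq_abs] at h2
  rw [← h2]; gcongr

section smooth
variable {n : ℕ} {u : ℝ → EuclideanSpace ℝ (Fin n) → ℝ}

lemma U_open : IsOpen (Ioi (0:ℝ) ×ˢ (univ : Set (EuclideanSpace ℝ (Fin n)))) :=
  isOpen_Ioi.prod isOpen_univ

lemma cda (hu : ContDiffOn ℝ ∞ (Function.uncurry u) (Ioi 0 ×ˢ univ)) {s : ℝ} (hs : 0 < s) (x) :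
    ContDiffAt ℝ ∞ (Function.uncurry u) (s, x) :=
  hu.contDiffAt (U_open.mem_nhds ⟨hs, mem_univ _⟩)

lemma cd_slice (hu : ContDiffOn ℝ ∞ (Function.uncurry u) (Ioi 0 ×ˢ univ)) {s : ℝ} (hs : 0 < s) :
    ContDiff ℝ ∞ (u s) := by
  rw [contDiff_iff_contDiffAt]
  intro x
  exact (cda hu hs x).comp x (contDiffAt_const.prodMk contDiffAt_id)

lemma hasFDerivAt_slice (hu : ContDiffOn ℝ ∞ (Function.uncurry u) (Ioi 0 ×ˢ univ)) {s : ℝ}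
    (hs : 0 < s) (x) : HasFDerivAt (u s)
      ((fderiv ℝ (Function.uncurry u) (s, x)).comp (ContinuousLinearMap.inr ℝ _ _)) x :=
  ((cda hu hs x).differentiableAt (by simp)).hasFDerivAt.comp x (hasFDerivAt_prodMk_right s x)

lemma hasDerivAt_slice (hu : ContDiffOn ℝ ∞ (Function.uncurry u) (Ioi 0 ×ˢ univ)) {s : ℝ}
    (hs : 0 < s) (x) : HasDerivAt (fun s => u s x)
      (fderiv ℝ (Function.uncurry u) (s, x) (1, 0)) s := by
  have h := ((cda hu hs x).differentiableAt (by simp)).hasFDerivAt.comp s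
    (hasFDerivAt_prodMk_left (𝕜 := ℝ) s x)
  have := h.hasDerivAt
  simp only [ContinuousLinearMap.comp_apply, ContinuousLinearMap.inl_apply] at this
  exact this

lemma cdo_fderiv (hu : ContDiffOn ℝ ∞ (Function.uncurry u) (Ioi 0 ×ˢ univ)) :
    ContDiffOn ℝ ∞ (fderiv ℝ (Function.uncurry u)) (Ioi 0 ×ˢ univ) :=
  hu.fderiv_of_isOpen U_open (by simp)

lemma cdo_spaceDeriv (hu : ContDiffOn ℝ ∞ (Function.uncurry u) (Ioi 0 ×ˢ univ)) (i : Fin n) :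
    ContDiffOn ℝ ∞ (Function.uncurry fun s => spaceDeriv (u s) i) (Ioi 0 ×ˢ univ) := by
  refine ((cdo_fderiv hu).clm_apply
    (contDiffOn_const (c := ((0:ℝ), EuclideanSpace.single i (1:ℝ))))).congr ?_
  rintro ⟨s, x⟩ ⟨hs, -⟩
  simp only [Function.uncurry, spaceDeriv]
  rw [(hasFDerivAt_slice hu hs x).fderiv]
  simp [Function.uncurry_def]

lemma cdo_deriv (hu : ContDiffOn ℝ ∞ (Function.uncurry u) (Ioi 0 ×ˢ univ)) :
    ContDiffOn ℝ ∞ (Function.uncurry fun s x => deriv (fun s => u s x) s) (Ioi 0 ×ˢ univ) := by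
  refine ((cdo_fderiv hu).clm_apply
    (contDiffOn_const (c := ((1:ℝ), (0 : EuclideanSpace ℝ (Fin n)))))).congr ?_
  rintro ⟨s, x⟩ ⟨hs, -⟩
  simp only [Function.uncurry]
  rw [(hasDerivAt_slice hu hs x).deriv]

lemma deriv_spaceDeriv (hu : ContDiffOn ℝ ∞ (Function.uncurry u) (Ioi 0 ×ˢ univ)) (i : Fin n)
    {s : ℝ} (hs : 0 < s) (x) :
    deriv (fun s => spaceDeriv (u s) i x) s = spaceDeriv (fun x => deriv (fun s => u s x) s) i x := by
  have hsym := (cda hu hs x).isSymmSndFDerivAt (by simp; exact ENat.LEInfty.out)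
  have hD := (((cdo_fderiv hu).contDiffAt (U_open.mem_nhds (show (s, x) ∈ _ from ⟨hs, mem_univ x⟩))).differentiableAt
    (by simp)).hasFDerivAt
  have h1 : HasDerivAt (fun s => spaceDeriv (u s) i x)
      (fderiv ℝ (fderiv ℝ (Function.uncurry u)) (s, x) (1, 0)
        (0, EuclideanSpace.single i 1)) s := by
    have h := (hD.comp s (hasFDerivAt_prodMk_left (𝕜 := ℝ) s x)).hasDerivAt
    have h' := h.clm_apply (hasDerivAt_const s ((0:ℝ), EuclideanSpace.single i (1:ℝ)))
    have h'' := h'.congr_of_eventuallyEq (f₁ := fun s => spaceDeriv (u s) i x) ?_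
    · simpa using h''
    · filter_upwards [lt_mem_nhds hs] with r hr
      unfold spaceDeriv
      rw [(hasFDerivAt_slice hu hr x).fderiv]; simp
  have h2 : HasFDerivAt (fun x => deriv (fun s => u s x) s)
      (((fderiv ℝ (fderiv ℝ (Function.uncurry u)) (s, x)).comp
        (ContinuousLinearMap.inr ℝ _ _)).flip (1, 0)) x := by
    have h := (hD.comp x (hasFDerivAt_prodMk_right (𝕜 := ℝ) s x))
    have h' := h.clm_apply (hasFDerivAt_const ((1:ℝ), (0 : EuclideanSpace ℝ (Fin n))) x)
    have h'' := h'.congr_of_eventuallyEq (f₁ := fun x => deriv (fun s => u s x) s) ?_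
    · simpa using h''
    · filter_upwards with y
      rw [(hasDerivAt_slice hu hs y).deriv]; simp
  rw [h1.deriv]
  unfold spaceDeriv
  rw [h2.fderiv, hsym]
  simp

lemma co_norm_fderiv (hu : ContDiffOn ℝ ∞ (Function.uncurry u) (Ioi 0 ×ˢ univ)) :
    ContinuousOn (Function.uncurry fun s x => ‖fderiv ℝ (u s) x‖) (Ioi 0 ×ˢ univ) := by
  have h : ContinuousOn (fun p => ‖(fderiv ℝ (Function.uncurry u) p).comp
      (ContinuousLinearMap.inr ℝ ℝ (EuclideanSpace ℝ (Fin n)))‖) (Ioi 0 ×ˢ univ) :=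
    ((cdo_fderiv hu).continuousOn.clm_comp continuousOn_const).norm
  refine h.congr ?_
  rintro ⟨s, x⟩ ⟨hs, -⟩
  simp only [Function.uncurry]
  rw [(hasFDerivAt_slice hu hs x).fderiv]

end smooth

lemma time_ftc {n : ℕ} (g g' : ℝ → EuclideanSpace ℝ (Fin n) → ℝ) {a b : ℝ} (hab : a ≤ b)
    (hd : ∀ s ∈ Icc a b, ∀ x, HasDerivAt (fun s => g s x) (g' s x) s)
    (hc : ContinuousOn (Function.uncurry g') (Icc a b ×ˢ univ))
    {k : Set (EuclideanSpace ℝ (Fin n))} (hk : IsCompact k)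
    (hs : ∀ s x, s ∈ Icc a b → x ∉ k → g' s x = 0)
    (ha : Integrable (g a)) (hb : Integrable (g b)) :
    (∫ x, g b x) - (∫ x, g a x) = ∫ s in a..b, ∫ x, g' s x := by
  rw [intervalIntegral_integral_swap]
  · rw [← integral_sub hb ha]
    congr 1; ext x
    symm
    apply intervalIntegral.integral_eq_sub_of_hasDerivAt
    · rw [uIcc_of_le hab]; exact fun s hs => hd s hs x
    · apply ContinuousOn.intervalIntegrable
      rw [uIcc_of_le hab]
      exact hc.comp (f := fun s => (s, x)) (by fun_prop) fun s hs => ⟨hs, mem_univ _⟩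
  · rw [uIoc_of_le hab, ← Measure.restrict_univ (μ := (volume : Measure (EuclideanSpace ℝ (Fin n)))),
      Measure.prod_restrict]
    have h1 : IntegrableOn (Function.uncurry g') (Icc a b ×ˢ k) (volume.prod volume) :=
      (hc.mono (prod_mono_right (subset_univ _))).integrableOn_compact (isCompact_Icc.prod hk)
    have h2 : IntegrableOn (Function.uncurry g') (Icc a b ×ˢ univ) (volume.prod volume) := by
      refine h1.of_forall_sdiff_eq_zero (measurableSet_Icc.prod MeasurableSet.univ) ?_
      rintro ⟨s, x⟩ ⟨⟨h3, -⟩, h4⟩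
      exact hs s x h3 fun h5 => h4 ⟨h3, h5⟩
    exact h2.mono_set (prod_mono_left Ioc_subset_Icc_self)

lemma cont_param {n : ℕ} (g : ℝ → EuclideanSpace ℝ (Fin n) → ℝ) {a b : ℝ}
    (hc : ContinuousOn (Function.uncurry g) (Icc a b ×ˢ univ))
    {k : Set (EuclideanSpace ℝ (Fin n))} (hk : IsCompact k)
    (hs : ∀ s x, s ∈ Icc a b → x ∉ k → g s x = 0) :
    ContinuousOn (fun s => ∫ x, g s x) (Icc a b) := by
  have := continuousOn_integral_bilinear_of_locally_integrable_of_compact_support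
    (μ := (volume : Measure (EuclideanSpace ℝ (Fin n))))
    (ContinuousLinearMap.mul ℝ ℝ) hk hc hs (g := fun _ => 1)
    (integrableOn_const hk.measure_lt_top.ne)
  simpa using this

lemma ibp {n : ℕ} {v w : EuclideanSpace ℝ (Fin n) → ℝ} (hv : ContDiff ℝ ∞ v)
    (hw : ContDiff ℝ ∞ w) (hc : HasCompactSupport v) (i : Fin n) :
    ∫ x, v x * spaceDeriv w i x = - ∫ x, spaceDeriv v i x * w x := by
  have hv' : Continuous (fun x => spaceDeriv v i x) :=
    (hv.continuous_fderiv (by simp)).clm_apply continuous_const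
  have hw' : Continuous (fun x => spaceDeriv w i x) :=
    (hw.continuous_fderiv (by simp)).clm_apply continuous_const
  have hc' : HasCompactSupport (fun x => spaceDeriv v i x) := hc.fderiv_apply (𝕜 := ℝ) _
  apply integral_mul_fderiv_eq_neg_fderiv_mul_of_integrable
  · exact (hv'.mul hw.continuous).integrable_of_hasCompactSupport hc'.mul_right
  · exact (hv.continuous.mul hw').integrable_of_hasCompactSupport hc.mul_right
  · exact (hv.continuous.mul hw.continuous).integrable_of_hasCompactSupport hc.mul_right
  · exact fun x _ => hv.differentiable (by simp) x
  · exact fun x _ => hw.differentiable (by simp) x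

lemma spaceDeriv_mul {n : ℕ} {v w : EuclideanSpace ℝ (Fin n) → ℝ} (hv : Differentiable ℝ v)
    (hw : Differentiable ℝ w) (i : Fin n) (x) :
    spaceDeriv (fun x => v x * w x) i x = v x * spaceDeriv w i x + spaceDeriv v i x * w x := by
  unfold spaceDeriv
  rw [fderiv_fun_mul (hv x) (hw x)]
  simp; ring

lemma cd_spaceDeriv {n : ℕ} {v : EuclideanSpace ℝ (Fin n) → ℝ} (hv : ContDiff ℝ ∞ v) (i : Fin n) :
    ContDiff ℝ ∞ (spaceDeriv v i) :=
  (hv.fderiv_right (m := ∞) (by simp)).clm_apply contDiff_const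

lemma cd_laplacian {n : ℕ} {v : EuclideanSpace ℝ (Fin n) → ℝ} (hv : ContDiff ℝ ∞ v) :
    Continuous (laplacian v) := by
  unfold laplacian
  exact continuous_finsetSum _ fun i _ => (cd_spaceDeriv (cd_spaceDeriv hv i) i).continuous

lemma green {n : ℕ} {v w : EuclideanSpace ℝ (Fin n) → ℝ} (hv : ContDiff ℝ ∞ v)
    (hw : ContDiff ℝ ∞ w) (hc : HasCompactSupport v) :
    ∫ x, v x * laplacian w x = - ∫ x, ∑ i, spaceDeriv v i x * spaceDeriv w i x := by
  unfold laplacian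
  simp_rw [Finset.mul_sum]
  have hc' : ∀ i, HasCompactSupport (spaceDeriv v i) := fun i => hc.fderiv_apply (𝕜 := ℝ) _
  rw [integral_finsetSum, integral_finsetSum, ← Finset.sum_neg_distrib]
  · exact Finset.sum_congr rfl fun i _ => ibp hv (cd_spaceDeriv hw i) hc i
  · intro i _
    exact ((cd_spaceDeriv hv i).continuous.mul (cd_spaceDeriv hw i).continuous).integrable_of_hasCompactSupport (hc' i).mul_right
  · intro i _
    exact (hv.continuous.mul (cd_spaceDeriv (cd_spaceDeriv hw i) i).continuous).integrable_of_hasCompactSupport hc.mul_right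

lemma cont_divFlux {n : ℕ} {u : ℝ → EuclideanSpace ℝ (Fin n) → ℝ} {ν : ℝ}
    {f : ℝ → EuclideanSpace ℝ (Fin n)}
    (hu : ContDiffOn ℝ ∞ (Function.uncurry u) (Ioi 0 ×ˢ univ))
    (hpde : ∀ t x, 0 < t →
            deriv (fun s => u s x) t + divFlux f (u t) x = ν * laplacian (u t) x)
    {s : ℝ} (hs : 0 < s) : Continuous (divFlux f (u s)) := by
  have h1 : divFlux f (u s) = fun x => ν * laplacian (u s) x - deriv (fun s => u s x) s := by
    ext x; linarith [hpde s x hs]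
  rw [h1]
  exact ((cd_laplacian (cd_slice hu hs)).const_mul ν).sub (cd_slice (cdo_deriv hu) hs).continuous

lemma energy {n : ℕ} {u : ℝ → EuclideanSpace ℝ (Fin n) → ℝ} {ν K ε : ℝ} (hν : 0 < ν) (hK : 0 < K)
    {f : ℝ → EuclideanSpace ℝ (Fin n)}
    (hu : ContDiffOn ℝ ∞ (Function.uncurry u) (Ioi 0 ×ˢ univ))
    (hpde : ∀ t x, 0 < t →
            deriv (fun s => u s x) t + divFlux f (u t) x = ν * laplacian (u t) x)
    (hb : ∀ t, 0 < t → ∀ x, |u t x| ≤ 1)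
    (hi : ∀ t, 0 < t → Integrable (fun x => ‖fderiv ℝ (u t) x‖))
    (hi1 : ∀ t, 0 < t → (∫ x, ‖fderiv ℝ (u t) x‖) ≤ 1)
    (hD : ∀ t, 0 < t → ∀ x, |divFlux f (u t) x| ≤ K * ‖fderiv ℝ (u t) x‖)
    {η : EuclideanSpace ℝ (Fin n) → ℝ} (hη : ContDiff ℝ ∞ η) (hηc : HasCompactSupport η)
    (hη0 : ∀ x, 0 ≤ η x) (hη1 : ∀ x, η x ≤ 1) (hηε : ∀ x, ‖fderiv ℝ η x‖ ≤ ε)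
    {a b : ℝ} (ha : 0 < a) (hab : a ≤ b) :
    2 * ν * ∫ s in a..b, ∫ x, η x * ‖fderiv ℝ (u s) x‖ ^ 2 ≤
      (∫ x, η x * u a x ^ 2) - (∫ x, η x * u b x ^ 2) + (2 * ν * ε + 2 * K) * (b - a) := by
  have hε : 0 ≤ ε := (norm_nonneg _).trans (hηε 0)
  have hsub : Icc a b ×ˢ (univ : Set (EuclideanSpace ℝ (Fin n))) ⊆ Ioi 0 ×ˢ univ :=
    prod_mono_left fun s hs => ha.trans_le hs.1
  have hηk : ∀ x, x ∉ tsupport η → η x = 0 := fun x hx => image_eq_zero_of_notMem_tsupport hx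
  have hint : ∀ s, 0 < s → Integrable fun x => η x * u s x ^ 2 := fun s hs =>
    (hη.continuous.mul ((cd_slice hu hs).continuous.pow 2)).integrable_of_hasCompactSupport
      hηc.mul_right
  have hftc := time_ftc (fun s x => η x * u s x ^ 2)
    (fun s x => 2 * (η x * u s x * deriv (fun s => u s x) s)) hab ?_ ?_ hηc.isCompact ?_
    (hint a ha) (hint b (ha.trans_le hab))
  rotate_left
  · intro s hs x
    have h := (hasDerivAt_slice hu (ha.trans_le hs.1) x).differentiableAt.hasDerivAt
    refine ((h.fun_pow 2).const_mul (η x)).congr_deriv ?_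
    push_cast; ring
  · have h1 := hu.continuousOn.mono hsub
    have h2 := (cdo_deriv hu).continuousOn.mono hsub
    have h3 : Continuous fun p : ℝ × EuclideanSpace ℝ (Fin n) => η p.2 :=
      hη.continuous.comp continuous_snd
    exact continuousOn_const.mul ((h3.continuousOn.mul h1).mul h2)
  · intro s x _ hx; simp [hηk x hx]
  have hcN : ContinuousOn (fun s => ∫ x, η x * ‖fderiv ℝ (u s) x‖ ^ 2) (Icc a b) := by
    refine cont_param _ ?_ hηc.isCompact ?_
    · have h3 : Continuous fun p : ℝ × EuclideanSpace ℝ (Fin n) => η p.2 :=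
        hη.continuous.comp continuous_snd
      exact h3.continuousOn.mul (((co_norm_fderiv hu).mono hsub).pow 2)
    · intro s x _ hx; simp [hηk x hx]
  have hcG : ContinuousOn (fun s => ∫ x, 2 * (η x * u s x * deriv (fun s => u s x) s)) (Icc a b) := by
    refine cont_param _ ?_ hηc.isCompact ?_
    · have h1 := hu.continuousOn.mono hsub
      have h2 := (cdo_deriv hu).continuousOn.mono hsub
      have h3 : Continuous fun p : ℝ × EuclideanSpace ℝ (Fin n) => η p.2 :=
        hη.continuous.comp continuous_snd
      exact continuousOn_const.mul ((h3.continuousOn.mul h1).mul h2)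
    · intro s x _ hx; simp [hηk x hx]
  have key : ∀ s ∈ Icc a b, ∫ x, 2 * (η x * u s x * deriv (fun s => u s x) s) ≤
      -(2 * ν) * (∫ x, η x * ‖fderiv ℝ (u s) x‖ ^ 2) + (2 * ν * ε + 2 * K) := by
    intro s hs
    have hs0 : 0 < s := ha.trans_le hs.1
    have hus := cd_slice hu hs0
    have hDc := cont_divFlux hu hpde hs0
    have hgr : Continuous fun x => ‖fderiv ℝ (u s) x‖ := (hus.continuous_fderiv (by simp)).norm
    have hv : ContDiff ℝ ∞ (fun x => η x * u s x) := hη.mul hus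
    have hvc : HasCompactSupport (fun x => η x * u s x) := hηc.mul_right
    have hG := green hv hus hvc
    have i1 : Integrable fun x => η x * u s x * laplacian (u s) x :=
      (hv.continuous.mul (cd_laplacian hus)).integrable_of_hasCompactSupport hvc.mul_right
    have i2 : Integrable fun x => η x * u s x * divFlux f (u s) x :=
      (hv.continuous.mul hDc).integrable_of_hasCompactSupport hvc.mul_right
    have i3 : Integrable fun x => η x * ‖fderiv ℝ (u s) x‖ ^ 2 :=
      (hη.continuous.mul (hgr.pow 2)).integrable_of_hasCompactSupport hηc.mul_right
    have e1 : ∫ x, 2 * (η x * u s x * deriv (fun s => u s x) s) =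
        2 * ν * (∫ x, η x * u s x * laplacian (u s) x)
          - 2 * ∫ x, η x * u s x * divFlux f (u s) x := by
      rw [← integral_const_mul, ← integral_const_mul, ← integral_sub (i1.const_mul _) (i2.const_mul _)]
      congr 1; ext x
      have := hpde s x hs0
      rw [show deriv (fun s => u s x) s = ν * laplacian (u s) x - divFlux f (u s) x by linarith]
      ring
    have e2 : (∫ x, η x * ‖fderiv ℝ (u s) x‖ ^ 2) - ε ≤
        ∫ x, ∑ i, spaceDeriv (fun x => η x * u s x) i x * spaceDeriv (u s) i x := by
      have i4 : Integrable fun x => ∑ i, spaceDeriv (fun x => η x * u s x) i x * spaceDeriv (u s) i x := by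
        refine integrable_finsetSum _ fun i _ => ?_
        exact ((cd_spaceDeriv hv i).continuous.mul (cd_spaceDeriv hus i).continuous).integrable_of_hasCompactSupport
          (HasCompactSupport.mul_right (hvc.fderiv_apply (𝕜 := ℝ) _))
      have : ∫ x, (η x * ‖fderiv ℝ (u s) x‖ ^ 2 - ε * ‖fderiv ℝ (u s) x‖) ≤
        ∫ x, ∑ i, spaceDeriv (fun x => η x * u s x) i x * spaceDeriv (u s) i x := by
        refine integral_mono (i3.sub ((hi s hs0).const_mul ε)) i4 fun x => ?_
        simp only
        have h1 : ∑ i, spaceDeriv (fun x => η x * u s x) i x * spaceDeriv (u s) i x =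
            η x * ‖fderiv ℝ (u s) x‖ ^ 2 + u s x * ∑ i, spaceDeriv η i x * spaceDeriv (u s) i x := by
          rw [norm_sq_fderiv, Finset.mul_sum, Finset.mul_sum, ← Finset.sum_add_distrib]
          refine Finset.sum_congr rfl fun i _ => ?_
          rw [spaceDeriv_mul (hη.differentiable (by simp)) (hus.differentiable (by simp))]
          ring
        rw [h1]
        have h2 : |u s x * ∑ i, spaceDeriv η i x * spaceDeriv (u s) i x| ≤
            1 * (ε * ‖fderiv ℝ (u s) x‖) := by
          rw [abs_mul]
          refine mul_le_mul (hb s hs0 x) ((sum_mul_le _ _ _).trans ?_) (abs_nonneg _) zero_le_one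
          gcongr; exact hηε x
        have := (abs_le.1 h2).1
        linarith
      rw [integral_sub i3 ((hi s hs0).const_mul ε), integral_const_mul] at this
      have := mul_le_mul_of_nonneg_left (hi1 s hs0) hε
      linarith
    have e3 : -K ≤ ∫ x, η x * u s x * divFlux f (u s) x := by
      have : ∫ x, -K * ‖fderiv ℝ (u s) x‖ ≤ ∫ x, η x * u s x * divFlux f (u s) x := by
        refine integral_mono ((hi s hs0).const_mul _) i2 fun x => ?_
        simp only
        have h1 : |η x * u s x * divFlux f (u s) x| ≤ 1 * 1 * (K * ‖fderiv ℝ (u s) x‖) := by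
          rw [abs_mul, abs_mul]
          have : |η x| ≤ 1 := by rw [abs_of_nonneg (hη0 x)]; exact hη1 x
          gcongr
          · exact hb s hs0 x
          · exact hD s hs0 x
        have := (abs_le.1 h1).1
        linarith
      rw [integral_const_mul] at this
      nlinarith [hi1 s hs0]
    rw [e1, hG]
    nlinarith
  have hmono : ∫ s in a..b, ∫ x, 2 * (η x * u s x * deriv (fun s => u s x) s) ≤
      ∫ s in a..b, (-(2 * ν) * (∫ x, η x * ‖fderiv ℝ (u s) x‖ ^ 2) + (2 * ν * ε + 2 * K)) := by
    refine intervalIntegral.integral_mono_on hab ?_ ?_ key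
    · exact ContinuousOn.intervalIntegrable (by rwa [uIcc_of_le hab])
    · refine ContinuousOn.intervalIntegrable ?_
      rw [uIcc_of_le hab]
      exact (hcN.const_smul (-(2*ν))).add continuousOn_const
  rw [intervalIntegral.integral_add, intervalIntegral.integral_const_mul,
    intervalIntegral.integral_const, smul_eq_mul] at hmono
  · linarith
  · refine ContinuousOn.intervalIntegrable ?_
    rw [uIcc_of_le hab]
    exact (hcN.const_smul (-(2*ν)))
  · simp

lemma grad_growth {n : ℕ} {u : ℝ → EuclideanSpace ℝ (Fin n) → ℝ} {ν K ε : ℝ} (hν : 0 < ν) (hK : 0 < K)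
    (hεK : 2 * ε * ν ≤ K)
    {f : ℝ → EuclideanSpace ℝ (Fin n)}
    (hu : ContDiffOn ℝ ∞ (Function.uncurry u) (Ioi 0 ×ˢ univ))
    (hpde : ∀ t x, 0 < t →
            deriv (fun s => u s x) t + divFlux f (u t) x = ν * laplacian (u t) x)
    (hD : ∀ t, 0 < t → ∀ x, |divFlux f (u t) x| ≤ K * ‖fderiv ℝ (u t) x‖)
    {φ ψ : EuclideanSpace ℝ (Fin n) → ℝ} (hφ : ContDiff ℝ ∞ φ) (hφc : HasCompactSupport φ)
    (hφ0 : ∀ x, 0 ≤ φ x) (hφ1 : ∀ x, φ x ≤ 1) (hφε : ∀ x, ‖fderiv ℝ φ x‖ ≤ ε)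
    (hψ : Continuous ψ) (hψc : HasCompactSupport ψ) (hψ0 : ∀ x, 0 ≤ ψ x)
    (hψ1 : ∀ x ∈ tsupport φ, ψ x = 1)
    {a b : ℝ} (ha : 0 < a) (hab : a ≤ b) :
    (∫ x, φ x ^ 2 * ‖fderiv ℝ (u b) x‖ ^ 2) - (∫ x, φ x ^ 2 * ‖fderiv ℝ (u a) x‖ ^ 2) ≤
      2 * K ^ 2 / ν * ∫ s in a..b, ∫ x, ψ x * ‖fderiv ℝ (u s) x‖ ^ 2 := by
  have hε : 0 ≤ ε := (norm_nonneg _).trans (hφε 0)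
  have hsub : Icc a b ×ˢ (univ : Set (EuclideanSpace ℝ (Fin n))) ⊆ Ioi 0 ×ˢ univ :=
    prod_mono_left fun s hs => ha.trans_le hs.1
  have hφk : ∀ x, x ∉ tsupport φ → φ x = 0 := fun x hx => image_eq_zero_of_notMem_tsupport hx
  have hφ2c : HasCompactSupport fun x => φ x ^ 2 := by
    simp_rw [pow_two]; exact hφc.mul_right
  have hint : ∀ s, 0 < s → Integrable fun x => φ x ^ 2 * ‖fderiv ℝ (u s) x‖ ^ 2 := fun s hs =>
    ((hφ.continuous.pow 2).mul (((cd_slice hu hs).continuous_fderiv (by simp)).norm.pow 2)).integrable_of_hasCompactSupport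
      hφ2c.mul_right
  have hcont : ContinuousOn (Function.uncurry fun s x => ∑ i, 2 * φ x ^ 2 * spaceDeriv (u s) i x *
      deriv (fun s => spaceDeriv (u s) i x) s) (Icc a b ×ˢ univ) := by
    have h3 : Continuous fun p : ℝ × EuclideanSpace ℝ (Fin n) => 2 * φ p.2 ^ 2 :=
      continuous_const.mul ((hφ.continuous.comp continuous_snd).pow 2)
    refine continuousOn_finsetSum _ fun i _ => ?_
    have h1 := (cdo_spaceDeriv hu i).continuousOn.mono hsub
    have h2 := (cdo_deriv (cdo_spaceDeriv hu i)).continuousOn.mono hsub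
    exact (h3.continuousOn.mul h1).mul h2
  have hzero : ∀ s x, s ∈ Icc a b → x ∉ tsupport φ → ∑ i, 2 * φ x ^ 2 * spaceDeriv (u s) i x *
      deriv (fun s => spaceDeriv (u s) i x) s = 0 := by
    intro s x _ hx; simp [hφk x hx]
  have hftc := time_ftc (fun s x => φ x ^ 2 * ‖fderiv ℝ (u s) x‖ ^ 2)
    (fun s x => ∑ i, 2 * φ x ^ 2 * spaceDeriv (u s) i x *
      deriv (fun s => spaceDeriv (u s) i x) s) hab ?_ hcont hφc.isCompact hzero
    (hint a ha) (hint b (ha.trans_le hab))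
  rotate_left
  · intro s hs x
    simp_rw [norm_sq_fderiv, Finset.mul_sum]
    refine HasDerivAt.fun_sum fun i _ => ?_
    have h := (hasDerivAt_slice (cdo_spaceDeriv hu i) (ha.trans_le hs.1) x).differentiableAt.hasDerivAt
    refine ((h.fun_pow 2).const_mul (φ x ^ 2)).congr_deriv ?_
    push_cast; ring
  have hcN : ContinuousOn (fun s => ∫ x, ψ x * ‖fderiv ℝ (u s) x‖ ^ 2) (Icc a b) := by
    refine cont_param _ ?_ hψc.isCompact ?_
    · have h3 : Continuous fun p : ℝ × EuclideanSpace ℝ (Fin n) => ψ p.2 :=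
        hψ.comp continuous_snd
      exact h3.continuousOn.mul (((co_norm_fderiv hu).mono hsub).pow 2)
    · intro s x _ hx; simp [image_eq_zero_of_notMem_tsupport hx]
  have hcG := cont_param _ hcont hφc.isCompact hzero
  have key : ∀ s ∈ Icc a b, ∫ x, ∑ i, 2 * φ x ^ 2 * spaceDeriv (u s) i x *
      deriv (fun s => spaceDeriv (u s) i x) s ≤
      2 * K ^ 2 / ν * ∫ x, ψ x * ‖fderiv ℝ (u s) x‖ ^ 2 := by
    intro s hs
    have hs0 : 0 < s := ha.trans_le hs.1
    have hus := cd_slice hu hs0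
    have hut : ContDiff ℝ ∞ fun x => deriv (fun s => u s x) s := cd_slice (cdo_deriv hu) hs0
    have hgr : Continuous fun x => ‖fderiv ℝ (u s) x‖ := (hus.continuous_fderiv (by simp)).norm
    have hW : ∀ i, ContDiff ℝ ∞ fun x => 2 * φ x ^ 2 * spaceDeriv (u s) i x := fun i =>
      (contDiff_const.mul (hφ.pow 2)).mul (cd_spaceDeriv hus i)
    have hWc : ∀ i, HasCompactSupport fun x => 2 * φ x ^ 2 * spaceDeriv (u s) i x := fun i =>
      (HasCompactSupport.mul_left (f := fun _ => (2:ℝ)) hφ2c).mul_right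
    have hW'c : ∀ i, HasCompactSupport (spaceDeriv (fun x => 2 * φ x ^ 2 * spaceDeriv (u s) i x) i) :=
      fun i => (hWc i).fderiv_apply (𝕜 := ℝ) _
    simp_rw [deriv_spaceDeriv hu _ hs0]
    rw [integral_finsetSum]
    swap
    · intro i _
      exact ((hW i).continuous.mul (cd_spaceDeriv hut i).continuous).integrable_of_hasCompactSupport
        (hWc i).mul_right
    rw [Finset.sum_congr rfl fun i _ => ibp (hW i) hut (hWc i) i, Finset.sum_neg_distrib]
    have hii : ∀ i ∈ Finset.univ, Integrable fun x => spaceDeriv (fun x => 2 * φ x ^ 2 * spaceDeriv (u s) i x) i x *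
        deriv (fun s => u s x) s := fun i _ =>
      ((cd_spaceDeriv (hW i) i).continuous.mul hut.continuous).integrable_of_hasCompactSupport
        (hW'c i).mul_right
    rw [← integral_finsetSum _ hii, ← integral_neg, ← integral_const_mul]
    refine integral_mono (integrable_finsetSum _ hii).neg
      (((hψ.mul (hgr.pow 2)).integrable_of_hasCompactSupport hψc.mul_right).const_mul _) fun x => ?_
    simp only
    have hexp : ∑ i, spaceDeriv (fun x => 2 * φ x ^ 2 * spaceDeriv (u s) i x) i x *
        deriv (fun s => u s x) s = 2 * φ x * (φ x * laplacian (u s) x +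
          2 * ∑ i, spaceDeriv φ i x * spaceDeriv (u s) i x) * deriv (fun s => u s x) s := by
      rw [← Finset.sum_mul]
      congr 1
      unfold laplacian
      rw [Finset.mul_sum, Finset.mul_sum, ← Finset.sum_add_distrib, Finset.mul_sum]
      refine Finset.sum_congr rfl fun i _ => ?_
      have hφd := hφ.differentiable (by simp)
      have e : (fun x => 2 * φ x ^ 2 * spaceDeriv (u s) i x) =
          fun x => φ x * (φ x * (2 * spaceDeriv (u s) i x)) := by ext x; ring
      have hd : Differentiable ℝ (spaceDeriv (u s) i) := (cd_spaceDeriv hus i).differentiable (by simp)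
      rw [e, spaceDeriv_mul hφd (hφd.fun_mul (hd.const_mul 2)), spaceDeriv_mul hφd (hd.const_mul 2),
        spaceDeriv_mul (differentiable_const 2) hd]
      have : spaceDeriv (fun _ : EuclideanSpace ℝ (Fin n) => (2:ℝ)) i x = 0 := by
        simp [spaceDeriv]
      rw [this]; ring
    rw [hexp]
    by_cases hx : x ∈ tsupport φ
    swap
    · rw [hφk x hx]
      have := hψ0 x
      simp only [mul_zero, zero_mul, neg_zero]; positivity
    rw [hψ1 x hx, one_mul]
    have hpx := hpde s x hs0
    rw [show deriv (fun s => u s x) s = ν * laplacian (u s) x - divFlux f (u s) x by linarith]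
    have hg := (sum_mul_le φ (u s) x).trans
      (mul_le_mul_of_nonneg_right (hφε x) (norm_nonneg _))
    have hd := hD s hs0 x
    have hp := hφ0 x
    have hp1 := hφ1 x
    have hP : 0 ≤ ‖fderiv ℝ (u s) x‖ := norm_nonneg _
    generalize ‖fderiv ℝ (u s) x‖ = P at *
    generalize laplacian (u s) x = L at *
    generalize divFlux f (u s) x = D at *
    generalize ∑ i, spaceDeriv φ i x * spaceDeriv (u s) i x = G at *
    generalize φ x = p at *
    clear * - hg hd hp hp1 hP hν hK hεK hε
    have h1 : (p * D) ^ 2 ≤ (K * P) ^ 2 := by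
      have h3 : |p * D| ≤ 1 * (K * P) := by
        rw [abs_mul, abs_of_nonneg hp]; gcongr
      rw [one_mul] at h3
      exact sq_le_sq.2 (h3.trans (le_abs_self _))
    have h2 : (2 * ν * G) ^ 2 ≤ (K * P) ^ 2 := by
      have h3 : |2 * ν * G| ≤ K * P := by
        rw [abs_mul, abs_of_pos (by positivity)]
        calc 2 * ν * |G| ≤ 2 * ν * (ε * P) := by gcongr
          _ = 2 * ε * ν * P := by ring
          _ ≤ K * P := by gcongr
      exact sq_le_sq.2 (h3.trans (le_abs_self _))
    rw [div_mul_eq_mul_div, le_div_iff₀ hν]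
    nlinarith [sq_nonneg (2 * ν * (p * L) - (p * D - 2 * ν * G)), sq_nonneg (p * D - 2 * ν * G)]
  have hmono : ∫ s in a..b, ∫ x, ∑ i, 2 * φ x ^ 2 * spaceDeriv (u s) i x *
      deriv (fun s => spaceDeriv (u s) i x) s ≤
      ∫ s in a..b, 2 * K ^ 2 / ν * ∫ x, ψ x * ‖fderiv ℝ (u s) x‖ ^ 2 := by
    refine intervalIntegral.integral_mono_on hab ?_ ?_ key
    · exact ContinuousOn.intervalIntegrable (by rwa [uIcc_of_le hab])
    · refine ContinuousOn.intervalIntegrable ?_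
      rw [uIcc_of_le hab]
      exact hcN.const_smul (2 * K ^ 2 / ν)
  rw [intervalIntegral.integral_const_mul] at hmono
  linarith

theorem enstrophy_smoothing_estimate (n : ℕ) (hn : 1 ≤ n) (K A : ℝ) (hK : 0 < K)
    (hA : 0 < A) :
    ∃ C : ℝ, 0 < C ∧
      ∀ (ν : ℝ), 0 < ν →
      ∀ (f : ℝ → EuclideanSpace ℝ (Fin n)),
        Differentiable ℝ f →
        LipschitzOnWith K.toNNReal f (Set.Icc (-1) 1) →
        (∀ v : ℝ, |v| ≤ 1 → ‖f v‖ ≤ A) →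
        ∀ (u : ℝ → EuclideanSpace ℝ (Fin n) → ℝ),
          ContDiffOn ℝ (⊤ : ℕ∞) (Function.uncurry u) (Set.Ici 0 ×ˢ Set.univ) →
          (∀ t x, 0 < t →
            deriv (fun s => u s x) t + divFlux f (u t) x = ν * laplacian (u t) x) →
          (∀ t, 0 ≤ t → ∀ x, |u t x| ≤ 1) →
          (∀ t, 0 ≤ t → Integrable (fun x => ‖fderiv ℝ (u t) x‖)) →
          (∀ t, 0 ≤ t → (∫ x, ‖fderiv ℝ (u t) x‖) ≤ 1) →
          (∀ t₀ τ : ℝ, 0 ≤ t₀ → 0 < τ → ∀ x,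
            u (t₀ + τ) x
              = (∫ y, heatKernel n (ν * τ) (x - y) * u t₀ y)
                - ∫ s in t₀..(t₀ + τ), ∫ y,
                    heatKernel n (ν * (t₀ + τ - s)) (x - y) * divFlux f (u s) y) →
          ∀ t, ν ≤ t → (∫ x, ‖fderiv ℝ (u t) x‖ ^ 2) ≤ C * ν⁻¹ := by
  have hM0 : (0:ℝ) < 2 * 2 ^ ((n : ℝ) / 2) + K / 2 := by positivity
  set M : ℝ := 2 * 2 ^ ((n : ℝ) / 2) + K / 2 with hM
  set C1 : ℝ := M + K with hC1
  have hC10 : 0 < C1 := by positivity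
  refine ⟨2 * (1 + K ^ 2) * C1, by positivity, ?_⟩
  intro ν hν f hf hL _ u hu0 hpde hb0 hi0 hi10 hDuh t ht
  have hu : ContDiffOn ℝ ∞ (Function.uncurry u) (Ioi 0 ×ˢ univ) :=
    hu0.mono (prod_mono_left Ioi_subset_Ici_self)
  have hb : ∀ t, 0 < t → ∀ x, |u t x| ≤ 1 := fun t h => hb0 t h.le
  have hi : ∀ t, 0 < t → Integrable (fun x => ‖fderiv ℝ (u t) x‖) := fun t h => hi0 t h.le
  have hi1 : ∀ t, 0 < t → (∫ x, ‖fderiv ℝ (u t) x‖) ≤ 1 := fun t h => hi10 t h.le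
  have hD : ∀ t, 0 < t → ∀ x, |divFlux f (u t) x| ≤ K * ‖fderiv ℝ (u t) x‖ := fun t h x =>
    divFlux_le hf ((cd_slice hu h).differentiable (by simp)) hK hL (hb t h) x
  obtain ⟨a, ha⟩ : ∃ a, a = t - ν / 2 := ⟨_, rfl⟩
  have hta : t = a + ν / 2 := by linarith
  have ha0 : 0 < a := by linarith
  have hat : a ≤ t := by linarith
  have ht0 : 0 < t := by linarith
  have hle1 : ∀ s, 0 < s → ∫⁻ y, ENNReal.ofReal ‖fderiv ℝ (u s) y‖ ≤ 1 := by
    intro s hs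
    rw [← ofReal_integral_eq_lintegral_ofReal (hi s hs)
      (Eventually.of_forall fun _ => norm_nonneg _), ← ENNReal.ofReal_one]
    exact ENNReal.ofReal_le_ofReal (hi1 s hs)
  have hL1 : ∫⁻ x, ‖u t x - u a x‖ₑ ≤ ENNReal.ofReal (M * ν) := by
    have h := L1_diff ν K hν hK.le f u a (ν / 2) (by positivity)
      ((cd_slice hu ha0).of_le (by simp)) (hb a ha0)
      (fun s y => ‖fderiv ℝ (u (max s a)) y‖) ?_ ?_ ?_ ?_
      (hDuh a (ν / 2) ha0.le (by positivity))
    · rw [← hta] at h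
      refine h.trans (ENNReal.ofReal_le_ofReal (le_of_eq ?_))
      rw [show 8 * (ν * (ν / 2)) = (2 * ν) ^ 2 by ring, Real.sqrt_sq (by positivity), hM]
      ring
    · exact (co_norm_fderiv hu).comp_continuous
        (f := fun p : ℝ × EuclideanSpace ℝ (Fin n) => (max p.1 a, p.2)) (by fun_prop)
        fun p => ⟨lt_max_of_lt_right ha0, mem_univ _⟩
    · intro s hs y
      rw [max_eq_left hs.1.le]
      exact hD s (ha0.trans hs.1) y
    · intro s hs
      rw [max_eq_left hs.1.le]
      exact hle1 s (ha0.trans hs.1)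
    · simp_rw [← ofReal_norm]
      exact hle1 a ha0
  have hca := (cd_slice hu ha0).continuous
  have hct := (cd_slice hu ht0).continuous
  have hdi : Integrable fun x => ‖u t x - u a x‖ := by
    have : Integrable fun x => u t x - u a x :=
      ⟨(hct.sub hca).aestronglyMeasurable, hL1.trans_lt ENNReal.ofReal_lt_top⟩
    exact this.norm
  have hdi1 : ∫ x, ‖u t x - u a x‖ ≤ M * ν := by
    have hm : AEStronglyMeasurable (fun x => u t x - u a x) volume :=
      (hct.sub hca).aestronglyMeasurable
    rw [integral_norm_eq_lintegral_enorm hm]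
    exact ENNReal.toReal_le_of_le_ofReal (by positivity) hL1
  have hε : 0 < K / (2 * ν) := by positivity
  have step1 : ∀ η : EuclideanSpace ℝ (Fin n) → ℝ, ContDiff ℝ ∞ η → HasCompactSupport η →
      (∀ x, 0 ≤ η x) → (∀ x, η x ≤ 1) → (∀ x, ‖fderiv ℝ η x‖ ≤ K / (2 * ν)) →
      ∫ s in a..t, ∫ x, η x * ‖fderiv ℝ (u s) x‖ ^ 2 ≤ C1 := by
    intro η h1 h2 h3 h4 h5
    have h := energy hν hK hu hpde hb hi hi1 hD h1 h2 h3 h4 h5 ha0 hat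
    have hI : ∀ v : EuclideanSpace ℝ (Fin n) → ℝ, Continuous v → Integrable fun x => η x * v x ^ 2 :=
      fun v hv => (h1.continuous.mul (hv.pow 2)).integrable_of_hasCompactSupport h2.mul_right
    have h6 : (∫ x, η x * u a x ^ 2) - (∫ x, η x * u t x ^ 2) ≤ 2 * (M * ν) := by
      rw [← integral_sub (hI _ hca) (hI _ hct)]
      refine le_trans (integral_mono ((hI _ hca).sub (hI _ hct)) (hdi.const_mul 2) fun x => ?_)
        (by rw [integral_const_mul]; linarith)
      simp only
      have e : η x * u a x ^ 2 - η x * u t x ^ 2 = η x * (-(u a x + u t x) * (u t x - u a x)) := by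
        ring
      rw [e, Real.norm_eq_abs]
      refine (le_abs_self _).trans ?_
      rw [abs_mul, abs_mul, abs_neg, abs_of_nonneg (h3 x)]
      have h7 : |u a x + u t x| ≤ 2 := by
        have := abs_add_le (u a x) (u t x)
        linarith [hb a ha0 x, hb t ht0 x]
      calc _ ≤ 1 * (2 * |u t x - u a x|) := by gcongr; exact h4 x
        _ = _ := one_mul _
    have h7 : (2 * ν * (K / (2 * ν)) + 2 * K) * (t - a) = 3 / 2 * K * ν := by
      rw [ha]; field_simp; ring
    rw [h7] at h
    have h8 : 2 * ν * ∫ s in a..t, ∫ x, η x * ‖fderiv ℝ (u s) x‖ ^ 2 ≤ 2 * ν * C1 := by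
      refine h.trans ?_
      rw [hC1]
      nlinarith [mul_pos hK hν]
    exact le_of_mul_le_mul_left h8 (by positivity)
  have hfin : ∀ R : ℝ, 0 < R → ∃ φ : EuclideanSpace ℝ (Fin n) → ℝ, ContDiff ℝ ∞ φ ∧
      HasCompactSupport φ ∧ (∀ x, ‖x‖ ≤ R → φ x = 1) ∧
      ∫ x, φ x ^ 2 * ‖fderiv ℝ (u t) x‖ ^ 2 ≤ 2 * (1 + K ^ 2) * C1 * ν⁻¹ := by
    intro R hR
    obtain ⟨φ, p1, p2, p3, p4, p5, p6⟩ := exists_cutoff n R (K / (2 * ν)) hR hε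
    refine ⟨φ, p1, p2, p5, ?_⟩
    obtain ⟨R', hR'⟩ := p2.isCompact.isBounded.subset_closedBall 0
    obtain ⟨ψ, q1, q2, q3, q4, q5, q6⟩ := exists_cutoff n (max R' 1) (K / (2 * ν)) (by positivity) hε
    have hψ1 : ∀ x ∈ tsupport φ, ψ x = 1 := fun x hx =>
      q5 x ((mem_closedBall_zero_iff.1 (hR' hx)).trans (le_max_left _ _))
    have hI := step1 ψ q1 q2 q3 q4 q6
    have hsub : Icc a t ×ˢ (univ : Set (EuclideanSpace ℝ (Fin n))) ⊆ Ioi 0 ×ˢ univ :=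
      prod_mono_left fun s hs => ha0.trans_le hs.1
    have hcN : ContinuousOn (fun s => ∫ x, ψ x * ‖fderiv ℝ (u s) x‖ ^ 2) (Icc a t) := by
      refine cont_param _ ?_ q2.isCompact ?_
      · have h3 : Continuous fun p : ℝ × EuclideanSpace ℝ (Fin n) => ψ p.2 :=
          q1.continuous.comp continuous_snd
        exact h3.continuousOn.mul (((co_norm_fderiv hu).mono hsub).pow 2)
      · intro s x _ hx; simp [image_eq_zero_of_notMem_tsupport hx]
    have hY0 : ∀ s, 0 ≤ ∫ x, ψ x * ‖fderiv ℝ (u s) x‖ ^ 2 := fun s =>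
      integral_nonneg fun x => mul_nonneg (q3 x) (by positivity)
    have hii : IntervalIntegrable (fun s => ∫ x, ψ x * ‖fderiv ℝ (u s) x‖ ^ 2) volume a t :=
      ContinuousOn.intervalIntegrable (by rwa [uIcc_of_le hat])
    have hpt : ∀ s ∈ Icc a t, (∫ x, φ x ^ 2 * ‖fderiv ℝ (u t) x‖ ^ 2) - 2 * K ^ 2 / ν * C1 ≤
        ∫ x, ψ x * ‖fderiv ℝ (u s) x‖ ^ 2 := by
      intro s hs
      have hs0 : 0 < s := ha0.trans_le hs.1
      have h := grad_growth hν hK (by field_simp; rfl) hu hpde hD p1 p2 p3 p4 p6 q1.continuous q2 q3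
        hψ1 hs0 hs.2
      have h2 : ∫ r in s..t, ∫ x, ψ x * ‖fderiv ℝ (u r) x‖ ^ 2 ≤ C1 :=
        (intervalIntegral.integral_mono_interval hs.1 hs.2 le_rfl
          (Eventually.of_forall hY0) hii).trans hI
      have h3 : ∫ x, φ x ^ 2 * ‖fderiv ℝ (u s) x‖ ^ 2 ≤ ∫ x, ψ x * ‖fderiv ℝ (u s) x‖ ^ 2 := by
        have hg : Continuous fun x => ‖fderiv ℝ (u s) x‖ ^ 2 :=
          ((cd_slice hu hs0).continuous_fderiv (by simp)).norm.pow 2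
        have hφ2c : HasCompactSupport fun x => φ x ^ 2 := by
          simp_rw [pow_two]; exact p2.mul_right
        refine integral_mono
          (((p1.continuous.pow 2).mul hg).integrable_of_hasCompactSupport hφ2c.mul_right)
          ((q1.continuous.mul hg).integrable_of_hasCompactSupport q2.mul_right) fun x => ?_
        simp only
        gcongr
        by_cases hx : x ∈ tsupport φ
        · rw [hψ1 x hx]; exact pow_le_one₀ (p3 x) (p4 x)
        · rw [image_eq_zero_of_notMem_tsupport hx]; simpa using q3 x
      have h4 : 2 * K ^ 2 / ν * ∫ r in s..t, ∫ x, ψ x * ‖fderiv ℝ (u r) x‖ ^ 2 ≤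
        2 * K ^ 2 / ν * C1 := by gcongr
      linarith
    have hint := intervalIntegral.integral_mono_on hat (by simp) hii hpt
    rw [intervalIntegral.integral_const, smul_eq_mul, show t - a = ν / 2 by linarith] at hint
    have h5 := hint.trans hI
    have h6 : (∫ x, φ x ^ 2 * ‖fderiv ℝ (u t) x‖ ^ 2) - 2 * K ^ 2 / ν * C1 ≤ 2 / ν * C1 := by
      rw [show 2 / ν * C1 = 2 * C1 / ν by ring, le_div_iff₀ hν]; linarith
    have h7 : 2 * (1 + K ^ 2) * C1 * ν⁻¹ = 2 / ν * C1 + 2 * K ^ 2 / ν * C1 := by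
      field_simp
    linarith
  by_cases hint : Integrable fun x => ‖fderiv ℝ (u t) x‖ ^ 2
  swap
  · rw [integral_undef hint]; positivity
  have hlim := (aecover_closedBall (μ := (volume : Measure (EuclideanSpace ℝ (Fin n))))
    (x := 0) (tendsto_id (α := ℝ) (x := atTop))).integral_tendsto_of_countably_generated hint
  refine le_of_tendsto hlim ?_
  filter_upwards [eventually_gt_atTop 0] with R hR
  obtain ⟨φ, p1, p2, p3, p4⟩ := hfin R hR
  refine le_trans ?_ p4
  rw [← integral_indicator measurableSet_closedBall]
  have hφ2c : HasCompactSupport fun x => φ x ^ 2 := by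
    simp_rw [pow_two]; exact p2.mul_right
  refine integral_mono (hint.indicator measurableSet_closedBall)
    (((p1.continuous.pow 2).mul (((cd_slice hu ht0).continuous_fderiv
      (by simp)).norm.pow 2)).integrable_of_hasCompactSupport hφ2c.mul_right) fun x => ?_
  simp only
  by_cases hx : x ∈ Metric.closedBall (0 : EuclideanSpace ℝ (Fin n)) (id R)
  · rw [indicator_of_mem hx, p3 x (mem_closedBall_zero_iff.1 hx)]; simp
  · rw [indicator_of_notMem hx]; positivity
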